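/- Let α be an irrational real number, let f : ℝ/ℤ → ℝ/ℤ be the rotation f(x) = x + α, and let T : ℝ/ℤ → (0,∞) be continuously differentiable (i.e., induced by a ℤ-periodic C¹ function on ℝ). Then the suspension pair (f,T) is not kinematic expansive: for every ρ > 0 there exist x ≠ y in ℝ/ℤ such that dist(f^n(x), f^n(y)) < ρ and |S_n(x) − S_n(y)| < ρ for all n ∈ ℤ. -/

import Mathlib

open Metric Set Filter Topology

/-- Birkhoff sums of the return time `T` along the `ℤ`-orbit of `f`. -/
noncomputable def suspSum {Y : Type*} (f : Equiv.Perm Y) (T : Y → ℝ)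
    (n : ℤ) (x : Y) : ℝ :=
  if 0 ≤ n then ∑ i ∈ Finset.range n.toNat, T ((f ^ (i : ℤ)) x)
  else -∑ i ∈ Finset.range (-n).toNat, T ((f ^ (-(i : ℤ) - 1)) x)

/-- A continuous periodic function on the line is uniformly continuous. -/
theorem periodic_uniform_estimate {u : ℝ → ℝ} (hu : Continuous u) (hp : Function.Periodic u 1)
    {ε : ℝ} (hε : 0 < ε) : ∃ d > 0, ∀ a b : ℝ, |a - b| < d → |u a - u b| < ε := by
  have huc := (isCompact_Icc (a := (-1 : ℝ)) (b := 2)).uniformContinuousOn_of_continuous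
    hu.continuousOn
  obtain ⟨d, hd, H⟩ := Metric.uniformContinuousOn_iff.1 huc ε hε
  refine ⟨min d 1, lt_min hd one_pos, fun a b hab => ?_⟩
  have h1 := Int.floor_le a
  have h2 := Int.lt_floor_add_one a
  have h3 := abs_lt.1 (hab.trans_le (min_le_right d 1))
  have := H (a - ⌊a⌋) ⟨by linarith, by linarith⟩ (b - ⌊a⌋)
    ⟨by linarith [h3.2], by linarith [h3.1]⟩
    (by rw [Real.dist_eq, sub_sub_sub_cancel_right]; exact hab.trans_le (min_le_left _ _))
  have hs : ∀ x : ℝ, u (x - ⌊a⌋) = u x := fun x => by simpa using hp.sub_int_mul_eq (x := x) ⌊a⌋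
  rwa [hs, hs, Real.dist_eq] at this

/-- Multiplication by a number coprime to `q` permutes the residues modulo `q`. -/
theorem exists_index_of_isCoprime {p : ℤ} {q : ℕ} (hq : 0 < q) (hpq : IsCoprime p q) (k : ℤ) :
    ∃ i < q, ∃ m : ℤ, (i : ℤ) * p = k + m * q := by
  obtain ⟨a, b, hab⟩ := hpq
  have hq' : (q : ℤ) ≠ 0 := by exact_mod_cast hq.ne'
  have h0 := Int.emod_nonneg (k * a) hq'
  have h1 := Int.emod_lt_of_pos (k * a) (show (0 : ℤ) < q by exact_mod_cast hq)
  refine ⟨((k * a) % q).toNat, by omega, -k * b - (k * a / q) * p, ?_⟩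
  rw [Int.toNat_of_nonneg h0, Int.emod_def]
  linear_combination k * hab

theorem periodic_add_intCast {u : ℝ → ℝ} (hp : Function.Periodic u 1) (x : ℝ) (m : ℤ) :
    u (x + m) = u x := by
  simpa using hp.int_mul m x

theorem sum_rational_rotation {u : ℝ → ℝ} (hp : Function.Periodic u 1) {p : ℤ} {q : ℕ}
    (hq : 0 < q) (hpq : IsCoprime p q) (x : ℝ) :
    ∑ i ∈ Finset.range q, u (x + i * (p / q : ℝ)) = ∑ j ∈ Finset.range q, u (x + j / q) := by
  choose e he m hm using fun k : ℤ => exists_index_of_isCoprime hq hpq k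
  have hq0 : (q : ℝ) ≠ 0 := by exact_mod_cast hq.ne'
  symm
  have hinj : Set.InjOn (fun j : ℕ => e j) (Finset.range q) := by
    intro j hj k hk hjk
    simp only [Finset.coe_range, Set.mem_Iio] at hj hk
    have h1 := hm j
    have h2 := hm k
    simp only at hjk
    rw [hjk, h2] at h1
    have h3 : (j : ℤ) ≡ k [ZMOD q] := by
      refine (Int.modEq_iff_dvd).2 ⟨m j - m k, by linear_combination h1⟩
    have := (Int.natCast_modEq_iff).1 h3
    exact Nat.ModEq.eq_of_lt_of_lt this hj hk
  have hmaps : Set.MapsTo (fun j : ℕ => e j) (Finset.range q) (Finset.range q) :=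
    fun j _ => by simpa using he j
  refine Finset.sum_nbij (fun j : ℕ => e j) hmaps hinj
    (Finset.surjOn_of_injOn_of_card_le _ hmaps hinj le_rfl) fun j _ => ?_
  have h : (e j : ℝ) * p = j + m j * q := by exact_mod_cast hm j
  rw [← periodic_add_intCast hp (x + j / q) (m j)]
  congr 1
  field_simp
  linear_combination -h

/-- Uniform smallness of the Birkhoff sums of a derivative along good rational approximations. -/
theorem abs_sum_deriv_le_of_approx {g g' : ℝ → ℝ} (hg : ∀ x, HasDerivAt g (g' x) x)
    (hp : Function.Periodic g 1) (hp' : Function.Periodic g' 1) {ε d : ℝ}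
    (H : ∀ a b : ℝ, |a - b| < d → |g' a - g' b| < ε)
    {α : ℝ} {p : ℤ} {q : ℕ} (hq : 0 < q) (hpq : IsCoprime p q)
    (hα : |q * α - p| ≤ 1 / q) (hqd : 1 / (q : ℝ) < d) (x : ℝ) :
    |∑ i ∈ Finset.range q, g' (x + i * α)| ≤ 2 * ε * q := by
  have hq0 : (0 : ℝ) < q := by exact_mod_cast hq
  have h1 : |∑ i ∈ Finset.range q, (g' (x + i * α) - g' (x + i * (p / q : ℝ)))| ≤ q * ε := by
    refine (Finset.abs_sum_le_sum_abs _ _).trans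
      ((Finset.sum_le_card_nsmul _ _ ε fun i hi => (H _ _ ?_).le).trans (by simp))
    have hi' : (i : ℝ) ≤ q := by exact_mod_cast (Finset.mem_range.1 hi).le
    refine lt_of_le_of_lt ?_ hqd
    have : x + i * α - (x + i * (p / q : ℝ)) = (i / q) * (q * α - p) := by field_simp; ring
    rw [this, abs_mul, abs_of_nonneg (by positivity)]
    calc (i / q : ℝ) * |q * α - p| ≤ 1 * |q * α - p| := by
          gcongr
          rwa [div_le_one hq0]
      _ ≤ _ := by rwa [one_mul]
  have h2 : |∑ j ∈ Finset.range q,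
      (g' (x + j / q) - q * (g (x + (j + 1 : ℕ) / q) - g (x + j / q)))| ≤ q * ε := by
    refine (Finset.abs_sum_le_sum_abs _ _).trans
      ((Finset.sum_le_card_nsmul _ _ ε fun j hj => ?_).trans (by simp))
    have hlt : x + (j : ℝ) / q < x + (j + 1 : ℕ) / q := by
      push_cast
      gcongr
      linarith
    obtain ⟨c, hc, hcs⟩ := exists_hasDerivAt_eq_slope g g' hlt
      (fun y _ => (hg y).continuousAt.continuousWithinAt) (fun y _ => hg y)
    have hw : x + ((j + 1 : ℕ) : ℝ) / q - (x + j / q) = 1 / q := by push_cast; ring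
    rw [hw, div_div_eq_mul_div, div_one] at hcs
    rw [mul_comm, ← hcs]
    refine (H _ _ (lt_of_le_of_lt ?_ hqd)).le
    rw [abs_le]
    constructor <;> linarith [hc.1, hc.2]
  have h3 : ∑ j ∈ Finset.range q, q * (g (x + (j + 1 : ℕ) / q) - g (x + j / q)) = 0 := by
    rw [← Finset.mul_sum, Finset.sum_range_sub (fun j : ℕ => g (x + j / q))]
    simp [div_self hq0.ne', hp x]
  rw [Finset.sum_sub_distrib, sum_rational_rotation hp' hq hpq] at h1
  rw [Finset.sum_sub_distrib, h3] at h2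
  rw [abs_le] at *
  constructor <;> linarith [h1.1, h1.2, h2.1, h2.2]

/-- An irrational number has good rational approximations with large denominators. -/
theorem exists_approx_large_den {α : ℝ} (hα : Irrational α) (N : ℕ) :
    ∃ (p : ℤ) (q : ℕ), N < q ∧ IsCoprime p q ∧ |q * α - p| ≤ 1 / q := by
  obtain ⟨δ, hδ, hδ'⟩ := Metric.eventually_nhds_iff.1
    (hα.eventually_forall_le_dist_cast_rat_of_den_le N)
  obtain ⟨n, hn⟩ := exists_nat_one_div_lt (half_pos hδ)
  obtain ⟨r, hr, hrn⟩ := Real.exists_rat_abs_sub_le_and_den_le α n.succ_pos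
  have hden : (1 : ℝ) ≤ r.den := by exact_mod_cast r.pos
  have hden0 : (0 : ℝ) < r.den := by linarith
  refine ⟨r.num, r.den, ?_, ?_, ?_⟩
  · by_contra! hle
    have h1 := @hδ' (δ / 2) (by rw [Real.dist_eq, sub_zero, abs_of_pos (half_pos hδ)]; linarith)
      r hle
    rw [Real.dist_eq] at h1
    have h2 : 1 / (((n.succ : ℕ) + 1 : ℝ) * r.den) ≤ 1 / ((n : ℝ) + 1) := by
      apply one_div_le_one_div_of_le (by positivity)
      push_cast
      nlinarith [(Nat.cast_nonneg n : (0 : ℝ) ≤ n)]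
    linarith
  · exact Rat.isCoprime_num_den r
  · have h : (r.den : ℝ) * α - r.num = r.den * (α - r) := by
      rw [mul_sub]
      congr 1
      exact_mod_cast (Rat.den_mul_eq_num r).symm
    rw [h, abs_mul, abs_of_pos hden0]
    refine (mul_le_mul_of_nonneg_left hr hden0.le).trans ?_
    have : (r.den : ℝ) * (1 / (((n.succ : ℕ) + 1 : ℝ) * r.den)) = 1 / ((n.succ : ℕ) + 1 : ℝ) := by
      field_simp
    rw [this]
    apply one_div_le_one_div_of_le hden0
    have : (r.den : ℝ) ≤ n.succ := by exact_mod_cast hrn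
    linarith

/-- The Birkhoff sums of the derivative of a periodic `C¹` function grow sublinearly. -/
theorem abs_sum_deriv_le {g g' : ℝ → ℝ} (hg : ∀ x, HasDerivAt g (g' x) x)
    (hc : Continuous g') (hp : Function.Periodic g 1) (hp' : Function.Periodic g' 1)
    {α : ℝ} (hα : Irrational α) {ε : ℝ} (hε : 0 < ε) :
    ∃ C : ℝ, 0 ≤ C ∧ ∀ (n : ℕ) (x : ℝ), |∑ i ∈ Finset.range n, g' (x + i * α)| ≤ ε * n + C := by
  obtain ⟨d, hd, H⟩ := periodic_uniform_estimate hc hp' (half_pos hε)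
  obtain ⟨N, hN⟩ := exists_nat_one_div_lt hd
  obtain ⟨p, q, hqN, hpq, hq⟩ := exists_approx_large_den hα (N + 1)
  have hq0 : 0 < q := by omega
  have hqd : 1 / (q : ℝ) < d := lt_of_le_of_lt
    (one_div_le_one_div_of_le (by positivity) (by exact_mod_cast hqN.le)) hN
  obtain ⟨M, hM⟩ := (hp'.isBounded_of_continuous one_ne_zero hc).exists_norm_le
  have hM' : ∀ x, |g' x| ≤ M := fun x => hM _ (mem_range_self x)
  have hM0 : 0 ≤ M := (abs_nonneg _).trans (hM' 0)
  refine ⟨q * M, by positivity, fun n => ?_⟩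
  induction n using Nat.strong_induction_on with
  | _ n ih =>
    intro x
    rcases lt_or_ge n q with hnq | hnq
    · refine (Finset.abs_sum_le_sum_abs _ _).trans
        ((Finset.sum_le_card_nsmul _ _ M fun i _ => hM' _).trans ?_)
      have : (n : ℝ) ≤ q := by exact_mod_cast hnq.le
      simp only [Finset.card_range, nsmul_eq_mul]
      have := mul_le_mul_of_nonneg_right this hM0
      have : 0 ≤ ε * n := by positivity
      linarith
    · obtain ⟨m, rfl⟩ := Nat.exists_eq_add_of_le hnq
      have h1 := ih m (by omega) (x + q * α)
      have h2 := abs_sum_deriv_le_of_approx hg hp hp' H hq0 hpq hq hqd x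
      rw [Finset.sum_range_add]
      have h3 : ∑ i ∈ Finset.range m, g' (x + ((q + i : ℕ) : ℝ) * α)
          = ∑ i ∈ Finset.range m, g' (x + q * α + i * α) := by
        refine Finset.sum_congr rfl fun i _ => ?_
        congr 1
        push_cast
        ring
      rw [h3]
      refine (abs_add_le _ _).trans ?_
      push_cast
      linarith

/-- Uniformly in `x`, moving `x` by `t` changes a Birkhoff sum by at most `K * |t|`, where `K`
bounds the Birkhoff sums of the derivative. -/
theorem abs_sum_sub_le {g g' : ℝ → ℝ} (hg : ∀ x, HasDerivAt g (g' x) x) {α K : ℝ} {n : ℕ}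
    (hK : ∀ x, |∑ i ∈ Finset.range n, g' (x + i * α)| ≤ K) (x y : ℝ) :
    |∑ i ∈ Finset.range n, g (y + i * α) - ∑ i ∈ Finset.range n, g (x + i * α)|
      ≤ K * |y - x| := by
  have hd : ∀ z, HasDerivAt (fun z => ∑ i ∈ Finset.range n, g (z + i * α))
      (∑ i ∈ Finset.range n, g' (z + i * α)) z := fun z =>
    HasDerivAt.fun_sum fun i _ => (hg _).comp_add_const _ _
  exact Convex.norm_image_sub_le_of_norm_hasDerivWithin_le
    (fun z _ => (hd z).hasDerivWithinAt) (fun z _ => hK z) convex_univ (mem_univ x) (mem_univ y)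

theorem sum_rotation_exchange (g : ℝ → ℝ) (α x : ℝ) (m n : ℕ) :
    ∑ i ∈ Finset.range m, g (x + n * α + i * α) - ∑ i ∈ Finset.range m, g (x + i * α)
      = ∑ i ∈ Finset.range n, g (x + m * α + i * α) - ∑ i ∈ Finset.range n, g (x + i * α) := by
  have key : ∀ a b : ℕ, ∑ i ∈ Finset.range b, g (x + a * α + i * α)
      = ∑ i ∈ Finset.range (a + b), g (x + i * α) - ∑ i ∈ Finset.range a, g (x + i * α) := by
    intro a b
    rw [Finset.sum_range_add, add_sub_cancel_left]
    refine Finset.sum_congr rfl fun i _ => ?_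
    congr 1
    push_cast
    ring
  rw [key, key, add_comm m n]
  ring

/-- A Denjoy–Koksma type estimate: the Birkhoff sums of a periodic `C¹` function along the
denominators of good approximations have small oscillation. -/
theorem exists_sum_oscillation_le {g g' : ℝ → ℝ} (hg : ∀ x, HasDerivAt g (g' x) x)
    (hc : Continuous g') (hp : Function.Periodic g 1) (hp' : Function.Periodic g' 1)
    {α : ℝ} (hα : Irrational α) {ε : ℝ} (hε : 0 < ε) :
    ∃ (p : ℤ) (q : ℕ), 0 < q ∧ |q * α - p| < ε ∧ ∀ x y : ℝ,
      |∑ i ∈ Finset.range q, g (y + i * α) - ∑ i ∈ Finset.range q, g (x + i * α)| < ε := by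
  have hε' : 0 < ε / 20 := by positivity
  obtain ⟨C, hC0, hC⟩ := abs_sum_deriv_le hg hc hp hp' hα hε'
  obtain ⟨N, hN⟩ := exists_nat_gt (max (C / (ε / 20)) (1 / ε))
  obtain ⟨p, q, hqN, hpq, hq⟩ := exists_approx_large_den hα N
  have hqN' : (N : ℝ) < q := by exact_mod_cast hqN
  have hq0 : 0 < q := by omega
  have hq0' : (0 : ℝ) < q := by exact_mod_cast hq0
  have hCq : C < q * (ε / 20) :=
    (div_lt_iff₀ hε').1 (((le_max_left _ _).trans_lt hN).trans hqN')
  have hqε : 1 / (q : ℝ) < ε := by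
    rw [div_lt_comm₀ hq0' hε]
    exact ((le_max_right _ _).trans_lt hN).trans hqN'
  have hK : ∀ n ≤ q, ∀ x, |∑ i ∈ Finset.range n, g' (x + i * α)| ≤ ε / 10 * q := by
    intro n hn x
    have h1 : (n : ℝ) ≤ q := by exact_mod_cast hn
    have h2 := mul_le_mul_of_nonneg_left h1 hε'.le
    linarith [hC n x]
  have hper : Function.Periodic (fun x => ∑ i ∈ Finset.range q, g (x + i * α)) 1 := by
    intro x
    refine Finset.sum_congr rfl fun i _ => ?_
    rw [add_right_comm, hp]
  have horbit : ∀ n ≤ q, ∀ x, |∑ i ∈ Finset.range q, g (x + n * α + i * α)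
      - ∑ i ∈ Finset.range q, g (x + i * α)| ≤ ε / 10 := by
    intro n hn x
    rw [sum_rotation_exchange]
    have h1 : ∑ i ∈ Finset.range n, g (x + q * α + i * α)
        = ∑ i ∈ Finset.range n, g (x + (q * α - p) + i * α) := by
      refine Finset.sum_congr rfl fun i _ => ?_
      rw [← periodic_add_intCast hp (x + (q * α - p) + i * α) p]
      congr 1
      ring
    rw [h1]
    refine (abs_sum_sub_le hg (hK n hn) _ _).trans ?_
    rw [add_sub_cancel_left]
    refine (mul_le_mul_of_nonneg_left hq (by positivity)).trans ?_
    rw [mul_assoc, mul_one_div_cancel hq0'.ne', mul_one]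
  refine ⟨p, q, hq0, hq.trans_lt hqε, fun x y => ?_⟩
  obtain ⟨i, hi, m, him⟩ := exists_index_of_isCoprime hq0 hpq ⌊(y - x) * q⌋
  have him' : (i : ℝ) * p = ⌊(y - x) * q⌋ + m * q := by exact_mod_cast him
  have hf1 := Int.floor_le ((y - x) * q)
  have hf2 := Int.lt_floor_add_one ((y - x) * q)
  have hi' : (i : ℝ) ≤ q := by exact_mod_cast hi.le
  have hclose : |y - (x + i * α - m)| ≤ 2 / q := by
    have h1 : y - (x + i * α - m)
        = ((y - x) * q - ⌊(y - x) * q⌋) / q - (i / q) * (q * α - p) := by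
      field_simp
      linear_combination -him'
    have h2 : |((y - x) * q - ⌊(y - x) * q⌋) / q| ≤ 1 / q := by
      rw [abs_of_nonneg (div_nonneg (by linarith) hq0'.le)]
      gcongr
      linarith
    have h3 : |(i / q : ℝ) * (q * α - p)| ≤ 1 / q := by
      rw [abs_mul, abs_of_nonneg (by positivity)]
      calc (i / q : ℝ) * |q * α - p| ≤ 1 * |q * α - p| := by
            gcongr
            rwa [div_le_one hq0']
        _ ≤ _ := by rwa [one_mul]
    rw [h1]
    refine (abs_sub _ _).trans ((add_le_add h2 h3).trans_eq ?_)
    ring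
  have h1 := abs_sum_sub_le hg (hK q le_rfl) (x + i * α - m) y
  have h2 := horbit i hi.le x
  have h3 : ∑ j ∈ Finset.range q, g (x + i * α - m + j * α)
      = ∑ j ∈ Finset.range q, g (x + i * α + j * α) := by
    have := periodic_add_intCast hper (x + i * α - m) m
    simpa using this.symm
  have h4 : ε / 10 * q * |y - (x + i * α - m)| ≤ ε / 5 := by
    refine (mul_le_mul_of_nonneg_left hclose (by positivity)).trans_eq ?_
    field_simp
    ring
  rw [h3] at h1
  have h5 := abs_le.1 (h1.trans h4)
  have h6 := abs_le.1 h2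
  rw [abs_lt]
  constructor <;> linarith [h5.1, h5.2, h6.1, h6.2]

theorem suspSum_add_one {Y : Type*} (f : Equiv.Perm Y) (T : Y → ℝ) (n : ℤ) (x : Y) :
    suspSum f T (n + 1) x = suspSum f T n x + T ((f ^ n) x) := by
  rcases lt_trichotomy n (-1) with h | rfl | h
  · obtain ⟨k, hk⟩ : ∃ k : ℕ, n = -(k : ℤ) - 1 := ⟨(-n - 1).toNat, by omega⟩
    subst hk
    have h1 : (-(-(k : ℤ) - 1 + 1)).toNat = k := by omega
    have h2 : (-(-(k : ℤ) - 1)).toNat = k + 1 := by omega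
    rw [suspSum, suspSum, if_neg (by omega), if_neg (by omega), h1, h2, Finset.sum_range_succ]
    ring
  · simp [suspSum]
  · obtain ⟨k, rfl⟩ : ∃ k : ℕ, n = k := ⟨n.toNat, by omega⟩
    have h1 : ((k : ℤ) + 1).toNat = k + 1 := by omega
    rw [suspSum, suspSum, if_pos (by omega), if_pos (by omega), h1, Finset.sum_range_succ,
      Int.toNat_natCast]

theorem suspSum_zero {Y : Type*} (f : Equiv.Perm Y) (T : Y → ℝ) (x : Y) :
    suspSum f T 0 x = 0 := by
  simp [suspSum]

theorem suspSum_add {Y : Type*} (f : Equiv.Perm Y) (T : Y → ℝ) (m n : ℤ) (x : Y) :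
    suspSum f T (m + n) x = suspSum f T m x + suspSum f T n ((f ^ m) x) := by
  induction n using Int.induction_on with
  | zero => simp [suspSum_zero]
  | succ k ih =>
    rw [← add_assoc, suspSum_add_one, suspSum_add_one, ih, ← Equiv.Perm.mul_apply, ← zpow_add,
      add_comm (k : ℤ) m, add_assoc]
  | pred k ih =>
    have h1 := suspSum_add_one f T (m + (-(k : ℤ) - 1)) x
    have h2 := suspSum_add_one f T (-(k : ℤ) - 1) ((f ^ m) x)
    rw [← Equiv.Perm.mul_apply, ← zpow_add, add_comm _ m] at h2
    rw [add_assoc, sub_add_cancel] at h1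
    rw [sub_add_cancel] at h2
    linarith

theorem rotation_zpow_apply {α : ℝ} {f : Equiv.Perm (AddCircle (1 : ℝ))}
    (hf : ∀ x : AddCircle (1 : ℝ), f x = x + (α : AddCircle (1 : ℝ))) (n : ℤ) (x : ℝ) :
    (f ^ n) (x : AddCircle (1 : ℝ)) = ((x + n * α : ℝ) : AddCircle (1 : ℝ)) := by
  induction n using Int.induction_on with
  | zero => simp
  | succ k ih =>
    rw [add_comm (k : ℤ) 1, zpow_add, zpow_one, Equiv.Perm.mul_apply, ih, hf, ← AddCircle.coe_add]
    congr 1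
    push_cast
    ring
  | pred k ih =>
    apply f.injective
    have : f ((f ^ (-(k : ℤ) - 1)) (x : AddCircle (1 : ℝ))) = (f ^ (-(k : ℤ))) x := by
      rw [← Equiv.Perm.mul_apply, ← zpow_one_add]
      congr 2
      ring
    rw [this, ih, hf, ← AddCircle.coe_add]
    congr 1
    push_cast
    ring

/-- No suspension of an irrational rotation of the circle with a `C¹` return
time is kinematic expansive. -/
theorem stmt11 (α : ℝ) (hα : Irrational α)
    (f : Equiv.Perm (AddCircle (1 : ℝ)))
    (hf : ∀ x : AddCircle (1 : ℝ), f x = x + (α : AddCircle (1 : ℝ)))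
    (T : AddCircle (1 : ℝ) → ℝ) (hTpos : ∀ x, 0 < T x)
    (hT : ∃ g : ℝ → ℝ, ContDiff ℝ 1 g ∧
      ∀ x : ℝ, T (x : AddCircle (1 : ℝ)) = g x) :
    ∀ ρ > (0 : ℝ), ∃ x y : AddCircle (1 : ℝ), x ≠ y ∧
      ∀ n : ℤ, dist ((f ^ n) x) ((f ^ n) y) < ρ ∧
        |suspSum f T n x - suspSum f T n y| < ρ := by
  intro ρ hρ
  obtain ⟨g, hgC, hTg⟩ := hT
  have hp : Function.Periodic g 1 := fun x => by
    rw [← hTg, ← hTg, AddCircle.coe_add, AddCircle.coe_period, add_zero]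
  have hg : ∀ x, HasDerivAt g (deriv g x) x := fun x =>
    (hgC.differentiable one_ne_zero x).hasDerivAt
  have hp' : Function.Periodic (deriv g) 1 := fun x => by
    rw [← deriv_comp_add_const]
    congr 1
    exact funext hp
  obtain ⟨p, q, hq, hqα, hosc⟩ := exists_sum_oscillation_le hg
    (hgC.continuous_deriv le_rfl) hp hp' hα hρ
  have hsum : ∀ x : ℝ, suspSum f T q (x : AddCircle (1 : ℝ))
      = ∑ i ∈ Finset.range q, g (x + i * α) := by
    intro x
    rw [suspSum, if_pos (by omega), Int.toNat_natCast]
    refine Finset.sum_congr rfl fun i _ => ?_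
    rw [rotation_zpow_apply hf, hTg, Int.cast_natCast]
  refine ⟨((q * α : ℝ) : AddCircle (1 : ℝ)), ((0 : ℝ) : AddCircle (1 : ℝ)), ?_, fun n => ⟨?_, ?_⟩⟩
  · intro h
    rw [AddCircle.coe_zero, AddCircle.coe_eq_zero_iff] at h
    obtain ⟨m, hm⟩ := h
    refine (hα.natCast_mul hq.ne').ne_int m ?_
    simpa using hm.symm
  · rw [rotation_zpow_apply hf, rotation_zpow_apply hf, dist_eq_norm, ← AddCircle.coe_sub,
      UnitAddCircle.norm_eq]
    refine lt_of_le_of_lt (round_le _ p) ?_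
    simpa using hqα
  · have h1 := suspSum_add f T q n ((0 : ℝ) : AddCircle (1 : ℝ))
    have h2 := suspSum_add f T n q ((0 : ℝ) : AddCircle (1 : ℝ))
    rw [add_comm n, h1, rotation_zpow_apply hf, rotation_zpow_apply hf, hsum, hsum, zero_add,
      zero_add, Int.cast_natCast] at h2
    have h3 := hosc 0 (n * α)
    have h4 : suspSum f T n ((q * α : ℝ) : AddCircle (1 : ℝ))
        - suspSum f T n ((0 : ℝ) : AddCircle (1 : ℝ))
        = ∑ i ∈ Finset.range q, g (n * α + i * α) - ∑ i ∈ Finset.range q, g (0 + i * α) := by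
      linarith
    rwa [h4]
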